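/- Let $S$ be a regular local ring of prime characteristic $p$ that is $F$-finite, $I \subseteq S$ an ideal, and $R = S/I$. For each $e \ge 0$, there is an isomorphism of $R$-modules $(I^{[p^e]} : I)/I^{[p^e]} \cong \mathrm{Hom}_R({}^e R, R)$, given by $\overline{s} \mapsto \overline{\mathrm{Tr}(s \cdot -)}$, where $\mathrm{Tr}$ is a generator of $\mathrm{Hom}_S({}^e S, S)$ as an ${}^e S$-module (Fedder's isomorphism). -/

import Mathlib

/-- A Noetherian local ring is regular if its maximal ideal is generated by
`dim R` elements. -/
def IsRegularLocal (S : Type*) [CommRing S] [IsLocalRing S] : Prop :=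
  IsNoetherianRing S ∧ ∃ (n : ℕ) (y : Fin n → S),
    Ideal.span (Set.range y) = IsLocalRing.maximalIdeal S ∧ ringKrullDim S = n

section FrobeniusFlatness

open RingTheory.Sequence Submodule Pointwise

theorem RingTheory.Sequence.IsWeaklyRegular.of_shortExact {R : Type*} [CommRing R]
    {M M' M'' : Type*} [AddCommGroup M] [Module R M] [AddCommGroup M'] [Module R M'] [AddCommGroup M'']
    [Module R M''] {f : M →ₗ[R] M'} {g : M' →ₗ[R] M''} (hf : Function.Injective f)
    (hfg : Function.Exact f g) (hg : Function.Surjective g) {rs : List R}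
    (h : IsWeaklyRegular M rs) (h'' : IsWeaklyRegular M'' rs) : IsWeaklyRegular M' rs := by
  induction rs generalizing M M' M'' with
  | nil => exact .nil R M'
  | cons r rs ih =>
    rw [isWeaklyRegular_cons_iff] at h h'' ⊢
    refine ⟨isSMulRegular_of_range_eq_ker hf (LinearMap.exact_iff.mp hfg).symm h.1 h''.1,
      ih (f := QuotSMulTop.map r f) (g := QuotSMulTop.map r g) ?_
        (QuotSMulTop.map_exact r hfg hg) (QuotSMulTop.map_surjective r hg) h.2 h''.2⟩
    have h0 : Function.Exact (0 : PUnit.{1} →ₗ[R] M) f := by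
      rwa [LinearMap.exact_zero_iff_injective]
    have := QuotSMulTop.map_first_exact_on_four_term_exact_of_isSMulRegular_last h0 hfg h''.1
    rw [map_zero] at this
    rwa [LinearMap.exact_zero_iff_injective] at this

theorem RingTheory.Sequence.IsWeaklyRegular.map_pow {R : Type*} [CommRing R] {M : Type*}
    [AddCommGroup M] [Module R M] {rs : List R} (h : IsWeaklyRegular M rs) (q : ℕ) :
    IsWeaklyRegular M (rs.map (· ^ q)) := by
  induction rs generalizing M with
  | nil => exact .nil R M
  | cons x xs ih =>
    rw [isWeaklyRegular_cons_iff] at h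
    rw [List.map_cons, isWeaklyRegular_cons_iff]
    refine ⟨h.1.pow q, ?_⟩
    have h1 := ih h.2
    clear ih
    generalize xs.map (· ^ q) = ys at h1
    induction q with
    | zero =>
      have : Subsingleton (QuotSMulTop (x ^ 0) M) := by
        rw [Submodule.Quotient.subsingleton_iff]
        simp
      rw [isWeaklyRegular_iff]
      exact fun i _ => Function.injective_of_subsingleton _
    | succ k ihk =>
      have hle : x ^ k • (⊤ : Submodule R M) ≤
          (x ^ (k + 1) • (⊤ : Submodule R M)).comap (LinearMap.lsmul R M x) := by
        intro a ha
        obtain ⟨b, -, rfl⟩ := (mem_smul_pointwise_iff_exists _ _ _).mp ha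
        refine (mem_smul_pointwise_iff_exists _ _ _).mpr ⟨b, trivial, ?_⟩
        simp [smul_smul, pow_succ, mul_comm]
      have hle' : x ^ (k + 1) • (⊤ : Submodule R M) ≤ x • (⊤ : Submodule R M) := by
        intro a ha
        obtain ⟨b, -, rfl⟩ := (mem_smul_pointwise_iff_exists _ _ _).mp ha
        refine (mem_smul_pointwise_iff_exists _ _ _).mpr ⟨x ^ k • b, trivial, ?_⟩
        simp [smul_smul, pow_succ']
      refine IsWeaklyRegular.of_shortExact (f := mapQ _ _ (LinearMap.lsmul R M x) hle)
        (g := factor hle') ?_ ?_ (factor_surjective hle') ihk h1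
      · rw [← LinearMap.ker_eq_bot, LinearMap.ker_eq_bot']
        intro a ha
        obtain ⟨a, rfl⟩ := mkQ_surjective _ a
        rw [mkQ_apply, mapQ_apply, Submodule.Quotient.mk_eq_zero,
          mem_smul_pointwise_iff_exists] at ha
        obtain ⟨b, -, hb⟩ := ha
        rw [mkQ_apply, Submodule.Quotient.mk_eq_zero, mem_smul_pointwise_iff_exists]
        refine ⟨b, trivial, h.1 ?_⟩
        simpa [smul_smul, pow_succ'] using hb
      · intro a
        obtain ⟨a, rfl⟩ := mkQ_surjective _ a
        constructor
        · intro ha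
          change (Submodule.Quotient.mk a : QuotSMulTop x M) = 0 at ha
          rw [Submodule.Quotient.mk_eq_zero,
            mem_smul_pointwise_iff_exists] at ha
          obtain ⟨b, -, rfl⟩ := ha
          exact ⟨Submodule.Quotient.mk b, rfl⟩
        · rintro ⟨b, hb⟩
          obtain ⟨b, rfl⟩ := mkQ_surjective _ b
          rw [← hb]
          change (Submodule.Quotient.mk (x • b) : QuotSMulTop x M) = 0
          rw [Submodule.Quotient.mk_eq_zero]
          exact smul_mem_pointwise_smul _ _ _ trivial

theorem IsLocalRing.free_of_isWeaklyRegular {R : Type*} [CommRing R] [IsLocalRing R]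
    [IsNoetherianRing R] {M : Type*} [AddCommGroup M] [Module R M] [Module.Finite R M]
    (rs : List R) (hrs : Ideal.ofList rs = maximalIdeal R) (h : IsWeaklyRegular M rs) :
    Module.Free R M := by
  generalize hn : rs.length = n
  induction n generalizing R M with
  | zero =>
    obtain rfl := List.length_eq_zero_iff.mp hn
    rw [Ideal.ofList_nil] at hrs
    let := (isField_iff_maximalIdeal_eq.mpr hrs.symm).toField
    exact Module.Free.of_divisionRing R M
  | succ n ih =>
    obtain ⟨x, rs, rfl⟩ := List.exists_cons_of_length_eq_add_one hn
    have hx : x ∈ maximalIdeal R := hrs ▸ Ideal.subset_span List.mem_cons_self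
    have : Nontrivial (R ⧸ Ideal.span {x}) :=
      Ideal.Quotient.nontrivial_iff.mpr fun h => by
        rw [Ideal.span_singleton_eq_top] at h
        exact hx h
    have : IsLocalRing (R ⧸ Ideal.span {x}) :=
      .of_surjective' (Ideal.Quotient.mk _) Ideal.Quotient.mk_surjective
    rw [isWeaklyRegular_cons_iff'] at h
    have := Module.finitePresentation_of_finite R M
    have := Module.Finite.of_restrictScalars_finite R (R ⧸ Ideal.span {x}) (QuotSMulTop x M)
    refine (Module.free_quotSMulTop_iff_free R M ?_ h.1).mp (ih _ ?_ h.2 ?_)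
    · rwa [IsLocalRing.jacobson_eq_maximalIdeal _ bot_ne_top]
    · rw [← Ideal.map_ofList, ← IsLocalRing.map_maximalIdeal_of_surjective _
        Ideal.Quotient.mk_surjective, ← hrs, Ideal.ofList_cons, Ideal.map_sup,
        Ideal.map_quotient_self, bot_sup_eq]
    · simpa using hn

theorem IsLocalRing.exists_isWeaklyRegular_of_le_ringKrullDim {R : Type*} [CommRing R]
    [IsLocalRing R] [IsNoetherianRing R] {n : ℕ} (y : Fin n → R)
    (hy : Ideal.span (Set.range y) = maximalIdeal R) (hn : n ≤ ringKrullDim R) :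
    IsDomain R ∧ ∃ rs : List R, Ideal.ofList rs = maximalIdeal R ∧ IsWeaklyRegular R rs := by
  induction n generalizing R with
  | zero =>
    have hm : maximalIdeal R = ⊥ := by simp [← hy]
    exact ⟨(isField_iff_maximalIdeal_eq.mpr hm).isDomain, [], by simp [hm], .nil R R⟩
  | succ n ih =>
    have hdim : ¬ maximalIdeal R ∈ minimalPrimes R := by
      intro h
      rw [← IsLocalRing.maximalIdeal_height_eq_ringKrullDim,
        Ideal.height_eq_zero_iff.mpr h] at hn
      norm_cast at hn
    obtain ⟨x, hxm, hx2, hxP⟩ : ∃ x ∈ maximalIdeal R, x ∉ maximalIdeal R ^ 2 ∧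
        ∀ P ∈ minimalPrimes R, x ∉ P := by
      by_contra! hcon
      have hfin := minimalPrimes.finite_of_isNoetherianRing R
      have hsub : (maximalIdeal R : Set R) ⊆ ⋃ i ∈ (↑(insert (maximalIdeal R ^ 2)
          hfin.toFinset) : Set (Ideal R)), ((id i : Ideal R) : Set R) := by
        intro x hx
        by_cases h2 : x ∈ maximalIdeal R ^ 2
        · exact Set.mem_biUnion (by simp) h2
        · obtain ⟨P, hP, hxP⟩ := hcon x hx h2
          exact Set.mem_biUnion (by simp [hP]) hxP
      rw [Ideal.subset_union_prime (maximalIdeal R ^ 2) (maximalIdeal R ^ 2)] at hsub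
      · obtain ⟨P, hP, hle⟩ := hsub
        rw [Finset.mem_insert, Set.Finite.mem_toFinset] at hP
        obtain rfl | hP := hP
        · have hbot : maximalIdeal R = ⊥ :=
            eq_bot_of_le_smul_of_le_jacobson_bot (maximalIdeal R) _ (IsNoetherian.noetherian _)
              (by simpa [pow_two] using hle) (IsLocalRing.maximalIdeal_le_jacobson _)
          exact hdim (Ideal.height_eq_zero_iff.mp (hbot ▸ Ideal.height_bot))
        · exact hdim (le_antisymm hle (IsLocalRing.le_maximalIdeal hP.1.1.ne_top) ▸ hP)
      · intro P hP h1 _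
        rw [Finset.mem_insert, Set.Finite.mem_toFinset] at hP
        exact (hP.resolve_left h1).1.1
    obtain ⟨c, hc⟩ := Ideal.mem_span_range_iff_exists_fun.mp (hy ▸ hxm)
    obtain ⟨i, hi⟩ : ∃ i, IsUnit (c i) := by
      by_contra! hcon
      refine hx2 (hc ▸ sum_mem fun i _ => ?_)
      rw [pow_two]
      exact Ideal.mul_mem_mul (hcon i) (hy ▸ Ideal.subset_span ⟨i, rfl⟩)
    have : Nontrivial (R ⧸ Ideal.span {x}) :=
      Ideal.Quotient.nontrivial_iff.mpr fun h => by
        rw [Ideal.span_singleton_eq_top] at h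
        exact hxm h
    have : IsLocalRing (R ⧸ Ideal.span {x}) :=
      .of_surjective' (Ideal.Quotient.mk _) Ideal.Quotient.mk_surjective
    have hspan : Ideal.span (Set.range fun j => Ideal.Quotient.mk (Ideal.span {x})
        (y (i.succAbove j))) = maximalIdeal (R ⧸ Ideal.span {x}) := by
      rw [← IsLocalRing.map_maximalIdeal_of_surjective _ Ideal.Quotient.mk_surjective, ← hy,
        Ideal.map_span, ← Set.range_comp]
      refine le_antisymm (Ideal.span_mono ?_) (Ideal.span_le.mpr ?_)
      · rintro _ ⟨j, rfl⟩
        exact ⟨_, rfl⟩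
      · rintro _ ⟨j, rfl⟩
        obtain rfl | ⟨j, rfl⟩ := Fin.eq_self_or_eq_succAbove i j
        · have h0 : Ideal.Quotient.mk (Ideal.span {x}) (∑ k, c k * y k) = 0 := by
            rw [hc]
            exact Ideal.Quotient.eq_zero_iff_mem.mpr (Ideal.mem_span_singleton_self x)
          rw [Fin.sum_univ_succAbove _ j, map_add, map_sum, map_mul] at h0
          rw [SetLike.mem_coe, Function.comp_apply,
            ← Ideal.unit_mul_mem_iff_mem _ (hi.map (Ideal.Quotient.mk (Ideal.span {x}))),
            eq_neg_of_add_eq_zero_left h0]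
          refine neg_mem (sum_mem fun k _ => ?_)
          rw [map_mul]
          exact Ideal.mul_mem_left _ _ (Ideal.subset_span ⟨k, rfl⟩)
        · exact Ideal.subset_span ⟨j, rfl⟩
    have hle : (n : WithBot ℕ∞) ≤ ringKrullDim (R ⧸ Ideal.span {x}) := by
      have h1 := Ideal.height_le_ringKrullDim_quotient_add_one hxm
      rw [IsLocalRing.maximalIdeal_height_eq_ringKrullDim] at h1
      have h2 := hn.trans h1
      rw [Nat.cast_add_one] at h2
      exact ENat.WithBot.add_le_add_one_right_iff.mp h2
    obtain ⟨hdom, rs', hrs', hreg⟩ := ih _ hspan hle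
    have hprime : (Ideal.span {x}).IsPrime :=
      (Ideal.Quotient.isDomain_iff_prime _).mp hdom
    obtain ⟨P, hP, hPx⟩ := Ideal.exists_minimalPrimes_le (bot_le (a := Ideal.span {x}))
    have hPprime : P.IsPrime := hP.1.1
    have hPbot : P = ⊥ := by
      refine eq_bot_of_le_smul_of_le_jacobson_bot (maximalIdeal R) _ (IsNoetherian.noetherian _)
        (fun a ha => ?_) (IsLocalRing.maximalIdeal_le_jacobson _)
      obtain ⟨b, rfl⟩ := Ideal.mem_span_singleton'.mp (hPx ha)
      rw [mul_comm]
      exact smul_mem_smul hxm ((hPprime.mem_or_mem ha).resolve_right (hxP P hP))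
    have hR : IsDomain R := by
      rw [hPbot] at hPprime
      exact IsDomain.of_bot_isPrime R
    obtain ⟨rs, rfl⟩ := List.map_surjective_iff.mpr
      (Ideal.Quotient.mk_surjective (I := Ideal.span {x})) rs'
    refine ⟨hR, x :: rs, ?_, ?_⟩
    · rw [← Ideal.map_ofList] at hrs'
      rw [← IsLocalRing.map_maximalIdeal_of_surjective _ Ideal.Quotient.mk_surjective,
        Ideal.map_eq_iff_sup_ker_eq_of_surjective _ Ideal.Quotient.mk_surjective,
        Ideal.mk_ker, sup_comm, ← Ideal.ofList_cons] at hrs'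
      rw [hrs', sup_eq_left, Ideal.span_singleton_le_iff_mem]
      exact hxm
    · rw [isWeaklyRegular_cons_iff]
      refine ⟨?_, ?_⟩
      · have : x ≠ 0 := by
          rintro rfl
          exact hx2 (zero_mem _)
        exact IsSMulRegular.of_ne_zero this
      · have h := (isWeaklyRegular_map_algebraMap_iff (R ⧸ Ideal.span {x}) _ rs).mp hreg
        have heq : Ideal.span {x} = x • (⊤ : Ideal R) := by simp [← ideal_span_singleton_smul]
        exact ((quotEquivOfEq _ _ heq).isWeaklyRegular_congr rs).mp h

theorem IsLocalRing.exists_coordinates_of_isWeaklyRegular {R T : Type*} [CommRing R]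
    [IsLocalRing R] [IsNoetherianRing R] [CommRing T] (f : R →+* T) (hf : f.Finite)
    (rs : List R) (hrs : Ideal.ofList rs = maximalIdeal R)
    (h : IsWeaklyRegular T (rs.map f)) :
    ∃ (m : ℕ) (b : Fin m → T) (ψ : Fin m → T →+ R),
      (∀ i r x, ψ i (f r * x) = r * ψ i x) ∧ ∀ x, x = ∑ i, f (ψ i x) * b i := by
  algebraize [f]
  have : Module.Finite R T := hf
  have h' : IsWeaklyRegular T rs := (isWeaklyRegular_map_algebraMap_iff T T rs).mp h
  have := IsLocalRing.free_of_isWeaklyRegular rs hrs h'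
  let b := Module.finBasis R T
  refine ⟨_, b, fun i => (b.coord i).toAddMonoidHom, fun i r x => ?_, fun x => ?_⟩
  · have : f r * x = r • x := (Algebra.smul_def r x).symm
    simp [this]
  · conv_lhs => rw [← b.sum_repr x]
    exact Finset.sum_congr rfl fun i _ => Algebra.smul_def _ _

theorem RingHom.Finite.iterateFrobenius {R : Type*} [CommRing R] {p : ℕ} [ExpChar R p]
    (h : (frobenius R p).Finite) (e : ℕ) : (iterateFrobenius R p e).Finite := by
  induction e with
  | zero => rw [iterateFrobenius_zero]; exact .id R
  | succ e ih =>
    rw [iterateFrobenius_add, iterateFrobenius_one]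
    exact ih.comp h

theorem IsRegularLocal.exists_frobenius_coordinates {S : Type*} [CommRing S] [IsLocalRing S]
    (hreg : IsRegularLocal S) (p : ℕ) [ExpChar S p] (hF : (frobenius S p).Finite) (e : ℕ) :
    ∃ (m : ℕ) (b : Fin m → S) (ψ : Fin m → S →+ S),
      (∀ i r x, ψ i (r ^ p ^ e * x) = r * ψ i x) ∧ ∀ x, x = ∑ i, ψ i x ^ p ^ e * b i := by
  obtain ⟨_, n, y, hy, hn⟩ := hreg
  obtain ⟨-, rs, hrs, hw⟩ :=
    IsLocalRing.exists_isWeaklyRegular_of_le_ringKrullDim y hy hn.ge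
  exact IsLocalRing.exists_coordinates_of_isWeaklyRegular _ (hF.iterateFrobenius e) rs hrs
    (hw.map_pow (p ^ e))

end FrobeniusFlatness

/-- **Fedder's isomorphism.** Let `S` be an `F`-finite regular local ring
of characteristic `p`, `I ⊆ S` an ideal, `R = S/I`, and `Tr` a generator of
`Hom_S(ᵉS, S)` as an `ᵉS`-module.  Then `s ↦ (x ↦ Tr(s·x) mod I)` induces an
`R`-module isomorphism `(I^{[pᵉ]} : I)/I^{[pᵉ]} ≅ Hom_R(ᵉR, R)`: every `s` in the colon
ideal induces a well-defined `p^{-e}`-linear map on `R`, every `p^{-e}`-linear map on `R`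
arises this way, and the kernel is exactly `I^{[pᵉ]}`. -/
theorem stmt10 {S : Type*} [CommRing S] [IsLocalRing S] (hreg : IsRegularLocal S)
    (p : ℕ) [Fact p.Prime] [CharP S p] (hF : (frobenius S p).Finite)
    (I : Ideal S) (e : ℕ)
    (Tr : S →+ S)
    (hTr : ∀ r x : S, Tr (r ^ p ^ e * x) = r * Tr x)
    (hTrGen : ∀ ψ : S →+ S, (∀ r x : S, ψ (r ^ p ^ e * x) = r * ψ x) →
      ∃ u : S, ∀ x : S, ψ x = Tr (u * x)) :
    -- notation: `Fpow = I^{[pᵉ]}`, `C = (I^{[pᵉ]} : I)`, `π = Ideal.Quotient.mk I`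
    (∀ s ∈ Submodule.colon (Ideal.span ((fun x => x ^ p ^ e) '' (I : Set S))) I,
      ∃ φ : (S ⧸ I) →+ (S ⧸ I),
        (∀ r x : S ⧸ I, φ (r ^ p ^ e * x) = r * φ x) ∧
        ∀ x : S, φ (Ideal.Quotient.mk I x) = Ideal.Quotient.mk I (Tr (s * x))) ∧
    (∀ φ : (S ⧸ I) →+ (S ⧸ I), (∀ r x : S ⧸ I, φ (r ^ p ^ e * x) = r * φ x) →
      ∃ s ∈ Submodule.colon (Ideal.span ((fun x => x ^ p ^ e) '' (I : Set S))) I,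
        ∀ x : S, φ (Ideal.Quotient.mk I x) = Ideal.Quotient.mk I (Tr (s * x))) ∧
    (∀ s ∈ Submodule.colon (Ideal.span ((fun x => x ^ p ^ e) '' (I : Set S))) I,
      ((∀ x : S, Ideal.Quotient.mk I (Tr (s * x)) = 0) ↔
        s ∈ Ideal.span ((fun x => x ^ p ^ e) '' (I : Set S)))) := by
  have : ExpChar S p := ExpChar.prime Fact.out
  obtain ⟨m, b, ψ, hψ, hb⟩ := hreg.exists_frobenius_coordinates p hF e
  choose u hu using fun i => hTrGen (ψ i) (hψ i)
  set J := Ideal.span ((fun x => x ^ p ^ e) '' (I : Set S))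
  have hpow : ∀ x ∈ I, x ^ p ^ e ∈ J := fun x hx => Ideal.subset_span ⟨x, hx, rfl⟩
  have hTrJ : ∀ t ∈ J, Tr t ∈ I := by
    intro t ht
    obtain ⟨c, hc, a, rfl⟩ := Submodule.mem_span_image_iff_exists_fun S |>.mp ht
    rw [map_sum]
    refine sum_mem fun x _ => ?_
    rw [smul_eq_mul, mul_comm, hTr]
    exact Ideal.mul_mem_right _ _ (hc x.2)
  have hmemJ : ∀ t, (∀ x, Tr (t * x) ∈ I) → t ∈ J := by
    intro t ht
    rw [hb t]
    refine sum_mem fun i _ => Ideal.mul_mem_right _ _ (hpow _ ?_)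
    rw [hu, mul_comm]
    exact ht _
  simp only [Submodule.mem_colon, SetLike.mem_coe, smul_eq_mul, Ideal.Quotient.eq_zero_iff_mem]
  refine ⟨fun s hs => ?_, fun φ hφ => ?_, fun s _ => ⟨hmemJ s, fun hs x =>
    hTrJ _ (Ideal.mul_mem_right _ _ hs)⟩⟩
  · let π : S →+ S ⧸ I := (Ideal.Quotient.mk I).toAddMonoidHom
    have hπ : Function.Surjective π := Ideal.Quotient.mk_surjective
    let g : S →+ S ⧸ I := π.comp (Tr.comp (AddMonoidHom.mulLeft s))
    have hker : π.ker ≤ g.ker := fun x hx => by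
      have hxI : x ∈ I := Ideal.Quotient.eq_zero_iff_mem.mp hx
      exact Ideal.Quotient.eq_zero_iff_mem.mpr (hTrJ _ (hs x hxI))
    have hφ : ∀ x : S, π.liftOfSurjective hπ ⟨g, hker⟩ (Ideal.Quotient.mk I x) =
        Ideal.Quotient.mk I (Tr (s * x)) :=
      AddMonoidHom.liftOfRightInverse_comp_apply π _ (Function.rightInverse_surjInv hπ) ⟨g, hker⟩
    refine ⟨π.liftOfSurjective hπ ⟨g, hker⟩, fun r x => ?_, hφ⟩
    obtain ⟨r, rfl⟩ := Ideal.Quotient.mk_surjective r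
    obtain ⟨x, rfl⟩ := Ideal.Quotient.mk_surjective x
    rw [← map_pow, ← map_mul, hφ, hφ, mul_left_comm, hTr, map_mul]
  · choose a ha using fun i => Ideal.Quotient.mk_surjective (φ (Ideal.Quotient.mk I (b i)))
    have hφx : ∀ x : S, φ (Ideal.Quotient.mk I x) =
        Ideal.Quotient.mk I (Tr ((∑ i, a i ^ p ^ e * u i) * x)) := by
      intro x
      conv_lhs => rw [hb x]
      rw [Finset.sum_mul, map_sum, map_sum, map_sum, map_sum]
      refine Finset.sum_congr rfl fun i _ => ?_
      rw [map_mul, map_pow, hφ, ← ha, ← map_mul, mul_assoc, hTr, ← hu, mul_comm]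
    refine ⟨_, fun x hx => hmemJ _ fun z => ?_, hφx⟩
    rw [mul_assoc, ← Ideal.Quotient.eq_zero_iff_mem, ← hφx,
      Ideal.Quotient.eq_zero_iff_mem.mpr (Ideal.mul_mem_right _ _ hx), map_zero]
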